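/- Let σ ∈ ℝ, a ∈ ℝ, ν > 0, and let f : [a,∞) → ℝ be continuously differentiable. Then for all x > a, the function x ↦ I_s^ν f(x) is differentiable and D_s[I_s^ν f](x) = I_s^ν[D_s f](x) + (f(a)/Γ(ν)) (x−a)^(ν−1) e^{−σ(x−a)}, where D_s g = g′ + σ g. -/

import Mathlib

open MeasureTheory Set

/-- The fractional substantial integral of order `ν` with lower terminal `a`. -/
noncomputable def Isub (σ a ν : ℝ) (f : ℝ → ℝ) : ℝ → ℝ :=
  fun x => (1 / Real.Gamma ν) * ∫ τ in a..x, (x - τ) ^ (ν - 1) * Real.exp (-σ * (x - τ)) * f τ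

/-- The substantial derivative operator `D_s f = f′ + σ f`. -/
noncomputable def Dsub (σ : ℝ) (f : ℝ → ℝ) : ℝ → ℝ := fun x => deriv f x + σ * f x

/-- The substitution `τ = x - (x - a) s` in an Abel-type integral. -/
lemma integral_sub_rpow_mul_eq_scaled {a x : ℝ} (ν : ℝ) (hx : a < x) (g : ℝ → ℝ) :
    ∫ τ in a..x, (x - τ) ^ (ν - 1) * g τ =
      (x - a) ^ ν * ∫ s in (0 : ℝ)..1, s ^ (ν - 1) * g (x - (x - a) * s) := by
  have hpos : 0 < x - a := sub_pos.2 hx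
  have hsub := intervalIntegral.integral_comp_sub_mul (a := 0) (b := 1)
    (fun τ => (x - τ) ^ (ν - 1) * g τ) hpos.ne' x
  have hends : ∫ τ in x - (x - a) * 1..x - (x - a) * 0, (x - τ) ^ (ν - 1) * g τ =
      ∫ τ in a..x, (x - τ) ^ (ν - 1) * g τ := by
    congr 1 <;> ring
  rw [hends, smul_eq_mul, eq_inv_mul_iff_mul_eq₀ hpos.ne'] at hsub
  rw [← hsub, ← intervalIntegral.integral_const_mul, ← intervalIntegral.integral_const_mul]
  refine intervalIntegral.integral_congr fun s hs => ?_
  rw [uIcc_of_le zero_le_one] at hs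
  have hν : (x - a) ^ ν = (x - a) * (x - a) ^ (ν - 1) := by
    rw [Real.rpow_sub_one hpos.ne']
    field_simp
  simp only [sub_sub_cancel]
  rw [Real.mul_rpow hpos.le hs.1, hν]
  ring

lemma intervalIntegrable_rpow_mul_comp {a x ν : ℝ} (hν : 0 < ν) (hx : a ≤ x) {g : ℝ → ℝ}
    (hg : ContinuousOn g (Ici a)) :
    IntervalIntegrable (fun s => s ^ (ν - 1) * g (x - (x - a) * s)) volume 0 1 := by
  refine (intervalIntegral.intervalIntegrable_rpow' (by linarith)).mul_continuousOn ?_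
  refine hg.comp (by fun_prop) fun s hs => ?_
  rw [uIcc_of_le zero_le_one] at hs
  rw [mem_Ici]
  nlinarith [hs.2]

lemma integral_rpow_mul_comp_by_parts {a x ν : ℝ} (hν : 0 < ν) (hx : a < x) {h k : ℝ → ℝ}
    (hh : ContinuousOn h (Ici a)) (hk : ContinuousOn k (Ici a))
    (hderiv : ∀ t > a, HasDerivAt h (k t) t) :
    ν * ∫ s in (0 : ℝ)..1, s ^ (ν - 1) * h (x - (x - a) * s) =
      h a + (x - a) * ∫ s in (0 : ℝ)..1, s ^ ν * k (x - (x - a) * s) := by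
  have hpos : 0 < x - a := sub_pos.2 hx
  have hi := (intervalIntegrable_rpow_mul_comp hν hx.le hh).const_mul ν
  have hi' : IntervalIntegrable (fun s => (x - a) * (s ^ ν * k (x - (x - a) * s))) volume 0 1 := by
    have := intervalIntegrable_rpow_mul_comp (ν := ν + 1) (by linarith) hx.le hk
    simp only [add_sub_cancel_right] at this
    exact this.const_mul _
  have hftc := intervalIntegral.integral_eq_sub_of_hasDerivAt_of_le zero_le_one
    (f := fun s => s ^ ν * h (x - (x - a) * s))
    (f' := fun s => ν * (s ^ (ν - 1) * h (x - (x - a) * s)) -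
      (x - a) * (s ^ ν * k (x - (x - a) * s))) ?_ ?_ (hi.sub hi')
  · rw [intervalIntegral.integral_sub hi hi', intervalIntegral.integral_const_mul,
      intervalIntegral.integral_const_mul] at hftc
    simp only [mul_one, sub_sub_cancel, Real.one_rpow, one_mul, Real.zero_rpow hν.ne', zero_mul,
      sub_zero] at hftc
    linarith
  · refine (continuousOn_id.rpow_const fun _ _ => Or.inr hν.le).mul
      (hh.comp (by fun_prop) fun s hs => ?_)
    rw [mem_Ici]
    nlinarith [hs.2]
  · intro s hs
    have hin : HasDerivAt (fun s => x - (x - a) * s) (-(x - a)) s := by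
      simpa using ((hasDerivAt_id s).const_mul (x - a)).const_sub x
    have hmem : a < x - (x - a) * s := by nlinarith [hs.2]
    refine ((Real.hasDerivAt_rpow_const (p := ν) (Or.inl hs.1.ne')).mul
      ((hderiv _ hmem).comp s hin)).congr_deriv ?_
    simp only [Function.comp]
    ring

lemma hasDerivAt_integral_rpow_mul_comp {a x ν : ℝ} (hν : 0 < ν) (hx : a < x) {h k : ℝ → ℝ}
    (hh : ContinuousOn h (Ici a)) (hk : ContinuousOn k (Ici a))
    (hderiv : ∀ t > a, HasDerivAt h (k t) t) :
    HasDerivAt (fun y => ∫ s in (0 : ℝ)..1, s ^ (ν - 1) * h (y - (y - a) * s))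
      (∫ s in (0 : ℝ)..1, s ^ (ν - 1) * ((1 - s) * k (x - (x - a) * s))) x := by
  obtain ⟨C, hC⟩ := (isCompact_Icc (a := a) (b := x + 1)).exists_bound_of_continuousOn
    (hk.mono Icc_subset_Ici_self)
  have hseg : ∀ y ∈ Ioo a (x + 1), ∀ s ∈ Ioo (0 : ℝ) 1,
      a < y - (y - a) * s ∧ y - (y - a) * s ≤ x + 1 := fun y hy s hs =>
    ⟨by nlinarith [hs.2, hy.1], by nlinarith [hs.1, hy.1, hy.2]⟩
  have hne : ∀ᵐ s : ℝ, s ≠ 1 := by simp [ae_iff]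
  refine (intervalIntegral.hasDerivAt_integral_of_dominated_loc_of_deriv_le
    (s := Ioo a (x + 1)) (bound := fun s => s ^ (ν - 1) * C)
    (F' := fun y s => s ^ (ν - 1) * ((1 - s) * k (y - (y - a) * s)))
    (Ioo_mem_nhds hx (by linarith)) ?_ (intervalIntegrable_rpow_mul_comp hν hx.le hh) ?_ ?_
    ((intervalIntegral.intervalIntegrable_rpow' (by linarith)).mul_const C) ?_).2
  · filter_upwards [Ioi_mem_nhds hx] with y hy
    exact (intervalIntegrable_iff.1
      (intervalIntegrable_rpow_mul_comp hν (le_of_lt hy) hh)).aestronglyMeasurable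
  · have hi := (intervalIntegrable_rpow_mul_comp hν hx.le hk).mul_continuousOn
      (g := fun s => 1 - s) (by fun_prop)
    refine (intervalIntegrable_iff.1 hi).aestronglyMeasurable.congr (ae_of_all _ fun s => ?_)
    ring
  · filter_upwards [hne] with s hs1 hs y hy
    rw [uIoc_of_le zero_le_one] at hs
    have hs' : s ∈ Ioo (0 : ℝ) 1 := ⟨hs.1, lt_of_le_of_ne hs.2 hs1⟩
    have hb := hC _ ⟨(hseg y hy s hs').1.le, (hseg y hy s hs').2⟩
    rw [norm_mul, norm_mul, Real.norm_of_nonneg (Real.rpow_nonneg hs.1.le _),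
      Real.norm_of_nonneg (sub_nonneg.2 hs.2)]
    refine mul_le_mul_of_nonneg_left ?_ (Real.rpow_nonneg hs.1.le _)
    exact (mul_le_of_le_one_left (norm_nonneg _) (by linarith [hs.1])).trans hb
  · filter_upwards [hne] with s hs1 hs y hy
    rw [uIoc_of_le zero_le_one] at hs
    have hs' : s ∈ Ioo (0 : ℝ) 1 := ⟨hs.1, lt_of_le_of_ne hs.2 hs1⟩
    have hin : HasDerivAt (fun y => y - (y - a) * s) (1 - s) y := by
      simpa using (hasDerivAt_id' y).fun_sub (((hasDerivAt_id' y).sub_const a).mul_const s)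
    refine (((hderiv _ (hseg y hy s hs').1).comp y hin).const_mul (s ^ (ν - 1))).congr_deriv ?_
    ring

/-- Differentiation of an Abel-type integral of a function that is `C¹` up to the terminal `a`. -/
lemma hasDerivAt_integral_sub_rpow_mul {a x ν : ℝ} (hν : 0 < ν) (hx : a < x) {h k : ℝ → ℝ}
    (hh : ContinuousOn h (Ici a)) (hk : ContinuousOn k (Ici a))
    (hderiv : ∀ t > a, HasDerivAt h (k t) t) :
    HasDerivAt (fun y => ∫ τ in a..y, (y - τ) ^ (ν - 1) * h τ)
      ((∫ τ in a..x, (x - τ) ^ (ν - 1) * k τ) + h a * (x - a) ^ (ν - 1)) x := by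
  have hpos : 0 < x - a := sub_pos.2 hx
  have hpow : HasDerivAt (fun y => (y - a) ^ ν) (ν * (x - a) ^ (ν - 1)) x := by
    simpa using ((hasDerivAt_id x).sub_const a).rpow_const (p := ν) (Or.inl hpos.ne')
  have hprod := hpow.mul (hasDerivAt_integral_rpow_mul_comp hν hx hh hk hderiv)
  refine (hprod.congr_of_eventuallyEq ?_).congr_deriv ?_
  · filter_upwards [Ioi_mem_nhds hx] with y hy
    exact integral_sub_rpow_mul_eq_scaled ν hy h
  · have hi := intervalIntegrable_rpow_mul_comp hν hx.le hk
    have hi' := intervalIntegrable_rpow_mul_comp (ν := ν + 1) (by linarith) hx.le hk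
    simp only [add_sub_cancel_right] at hi'
    have hsplit : ∫ s in (0 : ℝ)..1, s ^ (ν - 1) * ((1 - s) * k (x - (x - a) * s)) =
        (∫ s in (0 : ℝ)..1, s ^ (ν - 1) * k (x - (x - a) * s)) -
          ∫ s in (0 : ℝ)..1, s ^ ν * k (x - (x - a) * s) := by
      rw [← intervalIntegral.integral_sub hi hi']
      refine intervalIntegral.integral_congr_ae (ae_of_all _ fun s hs => ?_)
      rw [uIoc_of_le zero_le_one] at hs
      rw [Real.rpow_sub_one hs.1.ne']
      field_simp [hs.1.ne']
    have hparts := integral_rpow_mul_comp_by_parts hν hx hh hk hderiv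
    have hν' : (x - a) ^ ν = (x - a) * (x - a) ^ (ν - 1) := by
      rw [Real.rpow_sub_one hpos.ne']
      field_simp
    rw [hsplit, integral_sub_rpow_mul_eq_scaled ν hx k, hν']
    linear_combination (x - a) ^ (ν - 1) * hparts

/-- Factoring the exponential out of the fractional substantial integral. -/
lemma Isub_eq_exp_mul_integral (σ a ν : ℝ) (f : ℝ → ℝ) (x : ℝ) :
    Isub σ a ν f x = 1 / Real.Gamma ν *
      (Real.exp (-σ * x) * ∫ τ in a..x, (x - τ) ^ (ν - 1) * (Real.exp (σ * τ) * f τ)) := by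
  rw [Isub, ← intervalIntegral.integral_const_mul (Real.exp (-σ * x))]
  congr 1
  refine intervalIntegral.integral_congr (fun τ _ => ?_)
  have hexp : Real.exp (-σ * (x - τ)) = Real.exp (-σ * x) * Real.exp (σ * τ) := by
    rw [← Real.exp_add]
    ring_nf
  simp only [hexp]
  ring

/-- Lemma 2.5, Eq. (2.2): `I_s^ν f` is differentiable at `x > a` and
`D_s[I_s^ν f](x) = I_s^ν[D_s f](x) + (f(a)/Γ(ν)) (x−a)^(ν−1) e^{−σ(x−a)}`. -/
theorem substantial_derivative_of_integral
    (σ a ν : ℝ) (hν : 0 < ν) (f : ℝ → ℝ) (hf : ContDiffOn ℝ 1 f (Set.Ici a)) :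
    ∀ x > a, DifferentiableAt ℝ (Isub σ a ν f) x ∧
      Dsub σ (Isub σ a ν f) x = Isub σ a ν (Dsub σ f) x +
        f a / Real.Gamma ν * (x - a) ^ (ν - 1) * Real.exp (-σ * (x - a)) := by
  intro x hx
  have hdf : ∀ t > a, HasDerivAt f (derivWithin f (Ici a) t) t := fun t ht => by
    have hnhds : Ici a ∈ nhds t := Ici_mem_nhds ht
    rw [derivWithin_of_mem_nhds hnhds]
    exact ((hf.differentiableOn one_ne_zero).differentiableAt hnhds).hasDerivAt
  have hf' : ContinuousOn (derivWithin f (Ici a)) (Ici a) :=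
    hf.continuousOn_derivWithin (uniqueDiffOn_Ici a) le_rfl
  have hcont : ContinuousOn f (Ici a) := hf.continuousOn
  have hJ := hasDerivAt_integral_sub_rpow_mul hν hx
    (h := fun t => Real.exp (σ * t) * f t)
    (k := fun t => Real.exp (σ * t) * (derivWithin f (Ici a) t + σ * f t))
    (by fun_prop) (by fun_prop) fun t ht => by
      have hexp : HasDerivAt (fun t => Real.exp (σ * t)) (Real.exp (σ * t) * σ) t := by
        simpa using ((hasDerivAt_id t).const_mul σ).exp
      refine (hexp.mul (hdf t ht)).congr_deriv ?_
      ring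
  have hexp : HasDerivAt (fun y => Real.exp (-σ * y)) (Real.exp (-σ * x) * -σ) x := by
    simpa using ((hasDerivAt_id x).const_mul (-σ)).exp
  have hI := ((hexp.mul hJ).const_mul (1 / Real.Gamma ν)).congr_of_eventuallyEq
    (Filter.Eventually.of_forall (Isub_eq_exp_mul_integral σ a ν f))
  refine ⟨hI.differentiableAt, ?_⟩
  have hD : ∫ τ in a..x, (x - τ) ^ (ν - 1) * (Real.exp (σ * τ) * Dsub σ f τ) =
      ∫ τ in a..x, (x - τ) ^ (ν - 1) *
        (Real.exp (σ * τ) * (derivWithin f (Ici a) τ + σ * f τ)) := by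
    refine intervalIntegral.integral_congr_ae (ae_of_all _ fun τ hτ => ?_)
    rw [uIoc_of_le hx.le] at hτ
    rw [Dsub, (hdf τ hτ.1).deriv]
  have hsplit : Real.exp (-σ * (x - a)) = Real.exp (-σ * x) * Real.exp (σ * a) := by
    rw [← Real.exp_add]
    ring_nf
  rw [Dsub, hI.deriv, Isub_eq_exp_mul_integral σ a ν f, Isub_eq_exp_mul_integral σ a ν (Dsub σ f),
    hD, hsplit]
  ring
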